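/- Let H : [0,1] × ℂ → ℝ be a smooth function with H_t supported in the open unit disc D for all t, and let ξ_t = 2i ∂H_t/∂z̄. Then (1/(2π)) ∫₀¹ dt ∫_{D×D} (ξ_t(z₁) - ξ_t(z₂))/(z₁ - z₂) dm(z₁)dm(z₂) = -2i ∫₀¹ dt ∫_D H_t dm. -/

import Mathlib

open MeasureTheory

/-- The Wirtinger derivative `∂f/∂z̄ = (1/2)(∂f/∂x + i ∂f/∂y)`. -/
noncomputable def wirtinger (f : ℂ → ℂ) (z : ℂ) : ℂ :=
  (fderiv ℝ f z 1 + Complex.I * fderiv ℝ f z Complex.I) / 2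

theorem aux_fderiv_zero (f : ℂ → ℂ) (hs : Function.support f ⊆ Metric.ball (0:ℂ) 1)
    (z : ℂ) (hz : z ∉ Metric.closedBall (0:ℂ) 1) : fderiv ℝ f z = 0 := by
  by_contra h
  have h1 : z ∈ tsupport f := support_fderiv_subset ℝ h
  exact hz (closure_minimal (hs.trans Metric.ball_subset_closedBall) Metric.isClosed_closedBall h1)

theorem aux_integrable (f : ℂ → ℂ) (hf : ContDiff ℝ 1 f)
    (hs : Function.support f ⊆ Metric.ball (0:ℂ) 1) (w : ℂ) (v : ℝ → ℂ) (hv : Continuous v) :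
    IntegrableOn (fun p : ℝ × ℝ =>
      fderiv ℝ f (w + p.1 * (Real.cos p.2 + Real.sin p.2 * Complex.I)) (v p.2))
      (Set.Ioi 0 ×ˢ Set.Ioo (-Real.pi) Real.pi) := by
  have hc : Continuous (fun p : ℝ × ℝ =>
      fderiv ℝ f (w + p.1 * (Real.cos p.2 + Real.sin p.2 * Complex.I)) (v p.2)) := by
    have h1 := hf.continuous_fderiv (by norm_num)
    refine (h1.comp ?_).clm_apply (hv.comp continuous_snd)
    fun_prop
  have hK : IsCompact (Set.Icc (0:ℝ) (2 + ‖w‖) ×ˢ Set.Icc (-Real.pi) Real.pi) :=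
    isCompact_Icc.prod isCompact_Icc
  refine (hc.continuousOn.integrableOn_compact hK).of_forall_sdiff_eq_zero
    (measurableSet_Ioi.prod measurableSet_Ioo) ?_
  rintro ⟨r, θ⟩ ⟨⟨hr, hθ⟩, h2⟩
  simp only [Set.mem_Ioi, Set.mem_Ioo] at hr hθ
  have hr2 : 2 + ‖w‖ < r := by
    by_contra h
    exact h2 ⟨⟨hr.le, not_lt.1 h⟩, ⟨hθ.1.le, hθ.2.le⟩⟩
  have : fderiv ℝ f (w + r * (Real.cos θ + Real.sin θ * Complex.I)) = 0 := by
    apply aux_fderiv_zero f hs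
    have h3 : ‖(r * (Real.cos θ + Real.sin θ * Complex.I) : ℂ)‖ = r := by
      have := Complex.norm_polarCoord_symm (r, θ)
      rw [Complex.polarCoord_symm_apply] at this
      simpa [abs_of_pos hr] using this
    have h4 := norm_sub_le (w + r * (Real.cos θ + Real.sin θ * Complex.I)) w
    rw [add_sub_cancel_left, h3] at h4
    simp only [Metric.mem_closedBall, dist_zero_right, not_le]
    linarith
  simp only [this]
  simp

theorem aux_pompeiu (f : ℂ → ℂ) (hf : ContDiff ℝ 1 f)
    (hs : Function.support f ⊆ Metric.ball (0:ℂ) 1) (w : ℂ) :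
    ∫ z, wirtinger f z / (z - w) = -(Real.pi : ℂ) * f w := by
  rw [← integral_add_left_eq_self (fun z => wirtinger f z / (z - w)) w,
    ← Complex.integral_comp_polarCoord_symm]
  have hd : Differentiable ℝ f := hf.differentiable (by norm_num)
  set e : ℝ → ℂ := fun θ => Real.cos θ + Real.sin θ * Complex.I with he
  have hec : Continuous e := by fun_prop
  have hed : ∀ θ, HasDerivAt e (Complex.I * e θ) θ := by
    intro θ
    have h1 := (Real.hasDerivAt_cos θ).ofReal_comp
    have h2 := ((Real.hasDerivAt_sin θ).ofReal_comp).mul_const Complex.I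
    refine (h1.add h2).congr_deriv ?_
    simp only [he]
    push_cast
    linear_combination (-Complex.sin θ) * Complex.I_sq
  have hA := aux_integrable f hf hs w e hec
  have hB := aux_integrable f hf hs w (fun θ => Complex.I * e θ) (by fun_prop)
  change IntegrableOn (fun p : ℝ × ℝ => fderiv ℝ f (w + p.1 * e p.2) (e p.2))
    polarCoord.target at hA
  change IntegrableOn (fun p : ℝ × ℝ => fderiv ℝ f (w + p.1 * e p.2) (Complex.I * e p.2))
    polarCoord.target at hB
  have key : ∀ p ∈ polarCoord.target, p.1 • (wirtinger f (w + Complex.polarCoord.symm p) /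
      (w + Complex.polarCoord.symm p - w)) =
      (1/2:ℂ) * (fderiv ℝ f (w + p.1 * e p.2) (e p.2))
       + (Complex.I/2) * (fderiv ℝ f (w + p.1 * e p.2) (Complex.I * e p.2)) := by
    rintro ⟨r, θ⟩ ⟨hr, hθ⟩
    simp only [Set.mem_Ioi] at hr
    rw [Complex.polarCoord_symm_apply]
    simp only
    set L := fderiv ℝ f (w + r * e θ) with hL
    have h1 : L (e θ) = Real.cos θ * L 1 + Real.sin θ * L Complex.I := by
      have : e θ = Real.cos θ • (1:ℂ) + Real.sin θ • Complex.I := by simp [he]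
      rw [this, map_add, map_smul, map_smul]; simp
    have h2 : L (Complex.I * e θ) = -Real.sin θ * L 1 + Real.cos θ * L Complex.I := by
      have : Complex.I * e θ = (-Real.sin θ) • (1:ℂ) + Real.cos θ • Complex.I := by
        simp only [he, Complex.real_smul]
        push_cast
        linear_combination (Complex.sin θ) * Complex.I_sq
      rw [this, map_add, map_smul, map_smul]; simp
    have h3 : wirtinger f (w + r * e θ) = (L 1 + Complex.I * L Complex.I) / 2 := rfl
    change r • (wirtinger f (w + r * e θ) / (w + r * e θ - w)) = _
    rw [h1, h2, h3]
    have hr0 : (r:ℂ) ≠ 0 := by exact_mod_cast hr.ne'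
    have h4 : e θ * (Real.cos θ - Real.sin θ * Complex.I) = 1 := by
      have := Complex.cos_sq_add_sin_sq θ
      simp only [he]; push_cast
      linear_combination this - (Complex.sin θ)^2 * Complex.I_sq
    have he0 : e θ ≠ 0 := left_ne_zero_of_mul_eq_one h4
    rw [add_sub_cancel_left, Complex.real_smul]
    have h5 : (r:ℂ) * ((L 1 + Complex.I * L Complex.I) / 2 / (r * e θ))
        = (L 1 + Complex.I * L Complex.I) / 2 * (Real.cos θ - Real.sin θ * Complex.I) := by
      field_simp
      linear_combination (-(L 1 + Complex.I * L Complex.I)) * h4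
    rw [h5]
    linear_combination (-(Real.sin θ * L Complex.I)/2) * Complex.I_sq
  have htm : MeasurableSet polarCoord.target := measurableSet_Ioi.prod measurableSet_Ioo
  rw [setIntegral_congr_fun htm key]
  have hA' : ∫ p in polarCoord.target, fderiv ℝ f (w + p.1 * e p.2) (e p.2)
      = -(2 * Real.pi : ℂ) * f w := by
    have hin : ∀ θ : ℝ, ∫ r in Set.Ioi (0:ℝ), fderiv ℝ f (w + r * e θ) (e θ) = - f w := by
      intro θ
      have hn : ‖e θ‖ = 1 := by
        have := Complex.norm_polarCoord_symm (1, θ)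
        rw [Complex.polarCoord_symm_apply] at this
        simpa [he] using this
      have hzero : ∀ r : ℝ, 2 + ‖w‖ < r → w + r * e θ ∉ Metric.closedBall (0:ℂ) 1 := by
        intro r hr
        have h4 := norm_sub_le (w + r * e θ) w
        have hr0 : 0 < r := by linarith [norm_nonneg w]
        rw [add_sub_cancel_left, norm_mul, hn, mul_one, Complex.norm_real, Real.norm_eq_abs,
          abs_of_pos hr0] at h4
        simp only [Metric.mem_closedBall, dist_zero_right, not_le]
        linarith
      have hder : ∀ r ∈ Set.Ici (0:ℝ), HasDerivAt (fun r : ℝ => f (w + r * e θ))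
          (fderiv ℝ f (w + r * e θ) (e θ)) r := by
        intro r _
        have h1 := (((hasDerivAt_id r).ofReal_comp).mul_const (e θ)).const_add w
        have h2 := (hd (w + r * e θ)).hasFDerivAt.comp_hasDerivAt r h1
        refine h2.congr_deriv ?_
        simp
      have hcont : Continuous (fun r : ℝ => fderiv ℝ f (w + r * e θ) (e θ)) := by
        refine ((hf.continuous_fderiv (by norm_num)).comp ?_).clm_apply ?_ <;> fun_prop
      have hint : IntegrableOn (fun r : ℝ => fderiv ℝ f (w + r * e θ) (e θ)) (Set.Ioi 0) := by
        refine (hcont.continuousOn.integrableOn_compact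
          (isCompact_Icc (a := (0:ℝ)) (b := 2 + ‖w‖))).of_forall_sdiff_eq_zero measurableSet_Ioi ?_
        rintro r ⟨hr, h2⟩
        have hr2 : 2 + ‖w‖ < r := by
          by_contra h
          exact h2 ⟨le_of_lt hr, not_lt.1 h⟩
        rw [aux_fderiv_zero f hs _ (hzero r hr2)]
        simp
      have htend : Filter.Tendsto (fun r : ℝ => f (w + r * e θ)) Filter.atTop (nhds 0) := by
        refine tendsto_const_nhds.congr' ?_
        filter_upwards [Filter.eventually_gt_atTop (2 + ‖w‖)] with r hr
        by_contra h
        exact hzero r hr (Metric.ball_subset_closedBall (hs (Ne.symm h)))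
      rw [integral_Ioi_of_hasDerivAt_of_tendsto' hder hint htend]
      simp
    change ∫ p in (Set.Ioi (0:ℝ) ×ˢ Set.Ioo (-Real.pi) Real.pi), _ ∂(volume.prod volume) = _
    have hA2 := hA
    change IntegrableOn _ (Set.Ioi (0:ℝ) ×ˢ Set.Ioo (-Real.pi) Real.pi) _ at hA2
    rw [IntegrableOn, Measure.volume_eq_prod, ← Measure.prod_restrict] at hA2
    rw [← Measure.prod_restrict, integral_prod_symm _ hA2]
    rw [integral_congr_ae (Filter.Eventually.of_forall hin)]
    simp only [integral_const, Complex.real_smul]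
    rw [measureReal_restrict_apply_univ,
      Real.volume_real_Ioo_of_le (show -Real.pi ≤ Real.pi by linarith [Real.pi_pos])]
    push_cast
    ring
  have hB' : ∫ p in polarCoord.target, fderiv ℝ f (w + p.1 * e p.2) (Complex.I * e p.2) = 0 := by
    change ∫ p in (Set.Ioi (0:ℝ) ×ˢ Set.Ioo (-Real.pi) Real.pi), _ ∂(volume.prod volume) = _
    rw [setIntegral_prod _ hB]
    apply integral_eq_zero_of_ae
    refine (ae_restrict_iff' measurableSet_Ioi).2 (Filter.Eventually.of_forall fun r hr => ?_)
    simp only [Set.mem_Ioi] at hr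
    simp only [Pi.zero_apply]
    rw [← integral_Ioc_eq_integral_Ioo, ← intervalIntegral.integral_of_le (by linarith [Real.pi_pos])]
    have hr0 : (r:ℂ) ≠ 0 := by exact_mod_cast hr.ne'
    have hder : ∀ θ ∈ Set.uIcc (-Real.pi) Real.pi, HasDerivAt (fun θ => (r:ℂ)⁻¹ * f (w + r * e θ))
        (fderiv ℝ f (w + r * e θ) (Complex.I * e θ)) θ := by
      intro θ _
      have h1 := ((hed θ).const_mul (r:ℂ)).const_add w
      have h2 := ((hd (w + r * e θ)).hasFDerivAt.comp_hasDerivAt θ h1).const_mul (r:ℂ)⁻¹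
      refine h2.congr_deriv ?_
      rw [← Complex.real_smul (x := r) (z := Complex.I * e θ), map_smul, Complex.real_smul]
      field_simp
    rw [intervalIntegral.integral_eq_sub_of_hasDerivAt hder]
    · simp [he]
    · apply Continuous.intervalIntegrable
      refine ((hf.continuous_fderiv (by norm_num)).comp ?_).clm_apply ?_ <;> fun_prop
  rw [integral_add (hA.const_mul _) (hB.const_mul _), integral_const_mul, integral_const_mul,
    hA', hB']
  ring

theorem aux_prod (f : ℂ → ℂ) (hf : ContDiff ℝ 1 f)
    (hs : Function.support f ⊆ Metric.ball (0:ℂ) 1) :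
    ∫ p in Metric.closedBall (0:ℂ) 1 ×ˢ Metric.closedBall (0:ℂ) 1,
      (wirtinger f p.1 - wirtinger f p.2) / (p.1 - p.2) =
     -(2 * Real.pi : ℂ) * ∫ z in Metric.closedBall (0:ℂ) 1, f z := by
  set D := Metric.closedBall (0:ℂ) 1 with hD
  have hDm : MeasurableSet D := Metric.isClosed_closedBall.measurableSet
  have hDc : IsCompact D := isCompact_closedBall 0 1
  have hgc : Continuous (wirtinger f) := by
    have h1 := hf.continuous_fderiv (by norm_num)
    unfold wirtinger
    fun_prop
  have hli : LocallyIntegrable (fun z : ℂ => z⁻¹) := by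
    refine locallyIntegrable_of_norm_le_rpow (C := 1) (α := 1) ?_ ?_ ?_ ?_
    · simp
    · simp
    · refine Filter.Eventually.of_forall fun x => ?_
      simp [Real.rpow_neg_one]
    · exact measurable_inv.aestronglyMeasurable
  have hI : IntegrableOn (fun p : ℂ × ℂ => wirtinger f p.2 / (p.1 - p.2)) (D ×ˢ D)
      (volume.prod volume) := by
    have h1 : Integrable (D.indicator (wirtinger f)) :=
      (integrable_indicator_iff hDm).2 (hgc.continuousOn.integrableOn_compact hDc)
    have h2 : Integrable ((Metric.closedBall (0:ℂ) 2).indicator (fun z : ℂ => z⁻¹)) :=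
      (integrable_indicator_iff Metric.isClosed_closedBall.measurableSet).2
        (hli.integrableOn_isCompact (isCompact_closedBall 0 2))
    have h3 := h1.convolution_integrand (ContinuousLinearMap.mul ℝ ℂ) h2
    refine h3.integrableOn.congr_fun ?_ (hDm.prod hDm)
    rintro ⟨z, w⟩ ⟨hz, hw⟩
    simp only at hz hw
    have hzw : z - w ∈ Metric.closedBall (0:ℂ) 2 := by
      have := norm_sub_le z w
      simp only [hD, Metric.mem_closedBall, dist_zero_right] at hz hw ⊢
      linarith
    simp [Set.indicator_of_mem hw, Set.indicator_of_mem hzw, div_eq_mul_inv]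
  have hI2 : IntegrableOn (fun p : ℂ × ℂ => wirtinger f p.1 / (p.2 - p.1)) (D ×ˢ D)
      (volume.prod volume) := by
    rw [IntegrableOn, ← Measure.prod_restrict] at hI ⊢
    exact hI.swap
  have hval : ∫ p in D ×ˢ D, wirtinger f p.1 / (p.2 - p.1) ∂(volume.prod volume)
      = Real.pi * ∫ z in D, f z := by
    rw [← setIntegral_prod_swap, setIntegral_prod _ (by exact hI), ← integral_const_mul]
    refine setIntegral_congr_fun hDm fun w _ => ?_
    simp only [Prod.swap, Prod.fst, Prod.snd]
    have := aux_pompeiu f hf hs w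
    rw [setIntegral_eq_integral_of_forall_compl_eq_zero]
    · rw [← neg_neg (∫ x, wirtinger f x / (w - x)), ← integral_neg]
      simp only [← div_neg, neg_sub]
      rw [this]; ring
    · intro z hz
      simp [wirtinger, aux_fderiv_zero f hs z hz]
  have hval2 : ∫ p in D ×ˢ D, wirtinger f p.2 / (p.1 - p.2) ∂(volume.prod volume)
      = Real.pi * ∫ z in D, f z := by
    rw [← hval, ← setIntegral_prod_swap]; rfl
  change ∫ p in D ×ˢ D, _ ∂(volume.prod volume) = _
  have : ∀ p : ℂ × ℂ, (wirtinger f p.1 - wirtinger f p.2) / (p.1 - p.2)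
     = -(wirtinger f p.1 / (p.2 - p.1)) - wirtinger f p.2 / (p.1 - p.2) := by
    intro p
    rw [sub_div, ← div_neg, neg_sub]
  simp only [this]
  rw [integral_sub (by exact hI2.neg) hI, integral_neg, hval, hval2]
  ring

theorem stmt_10 (H : ℝ → ℂ → ℝ) (ξ : ℝ → ℂ → ℂ)
    (hH : ContDiff ℝ (⊤ : ℕ∞) (fun p : ℝ × ℂ => H p.1 p.2))
    (hsupp : ∀ t, Function.support (H t) ⊆ Metric.ball (0:ℂ) 1)
    (hξ : ∀ t z, ξ t z = 2 * Complex.I * wirtinger (fun u => (H t u : ℂ)) z) :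
    (1 / (2 * (Real.pi : ℂ))) *
        ∫ t in (0:ℝ)..1,
          ∫ p in Metric.closedBall (0:ℂ) 1 ×ˢ Metric.closedBall (0:ℂ) 1,
            (ξ t p.1 - ξ t p.2) / (p.1 - p.2)
      = -2 * Complex.I *
          ∫ t in (0:ℝ)..1, ∫ z in Metric.closedBall (0:ℂ) 1, (H t z : ℂ) := by
  have hpi : (Real.pi : ℂ) ≠ 0 := by exact_mod_cast Real.pi_ne_zero
  rw [← intervalIntegral.integral_const_mul, ← intervalIntegral.integral_const_mul]
  refine intervalIntegral.integral_congr fun t _ => ?_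
  have hf : ContDiff ℝ 1 (fun u => (H t u : ℂ)) := by
    have h1 : ContDiff ℝ (⊤ : ℕ∞) (fun u : ℂ => H t u) :=
      hH.comp (contDiff_const.prodMk contDiff_id)
    exact Complex.ofRealCLM.contDiff.comp (h1.of_le (by exact_mod_cast le_top))
  have hs : Function.support (fun u => (H t u : ℂ)) ⊆ Metric.ball (0:ℂ) 1 := by
    intro u hu
    apply hsupp t
    simpa using hu
  have h := aux_prod _ hf hs
  simp only [hξ, ← mul_sub, mul_div_assoc]
  simp only [integral_const_mul]
  simp only [mul_div_assoc] at h
  rw [h]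
  field_simp
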